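/- Let B ≥ 2 and A ≥ B², and let C > 0 and κ > 0. Then #{a ∈ 𝕃^loc(A) : 𝔖_a(B)·𝔍_a(B) ≤ C/(log log A)^κ} ≪ A⁴/(log log A)^{κ/3}, where the implied constant depends at most on C and κ. -/

import Mathlib

open Filter MeasureTheory Finset Topology
open scoped ENNReal

noncomputable section

/-- Euclidean norm of an integer quadruple. -/
def znorm (a : Fin 4 → ℤ) : ℝ := Real.sqrt (∑ i, ((a i : ℝ)) ^ 2)

/-- Euclidean norm of a natural-number quadruple. -/
def pnorm (x : Fin 4 → ℕ) : ℝ := Real.sqrt (∑ i, ((x i : ℝ)) ^ 2)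

/-- Sup-norm `|a| = maxᵢ |aᵢ|` of an integer quadruple. -/
def snorm (a : Fin 4 → ℤ) : ℕ := Finset.univ.sup fun i => (a i).natAbs

/-- Min of the absolute values of the coordinates. -/
def minAbs (a : Fin 4 → ℤ) : ℕ := Finset.univ.inf' Finset.univ_nonempty fun i => (a i).natAbs

/-- `a` is primitive: all coordinates nonzero and gcd of the coordinates is 1. -/
def IsPrimitive (a : Fin 4 → ℤ) : Prop := (∀ i, a i ≠ 0) ∧ Finset.univ.gcd a = 1

/-- `a` is locally solvable: it is primitive, its coordinates are not all of the same
sign, and for every prime `p` the congruence `⟨a,x⟩ ≡ 0 (mod p)` has a solution in the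
reduced residues mod `p`. -/
def IsLocSolv (a : Fin 4 → ℤ) : Prop :=
  IsPrimitive a ∧ ¬ ((∀ i, 0 < a i) ∨ (∀ i, a i < 0)) ∧
  ∀ p : ℕ, p.Prime → ∃ x : Fin 4 → (ZMod p)ˣ,
    ∑ i, (a i : ZMod p) * ((x i : (ZMod p)ˣ) : ZMod p) = 0

/-- The set `L(a)` of quadruples of primes solving `⟨a,p⟩ = 0`. -/
def Lsol (a : Fin 4 → ℤ) : Set (Fin 4 → ℕ) :=
  {p | (∀ i, (p i).Prime) ∧ ∑ i, a i * (p i : ℤ) = 0}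

/-- `𝔪(a)`: the minimum of `|p|` over prime solutions `p ∈ L(a)`, and `∞` if there is
no solution. -/
def mfrak (a : Fin 4 → ℤ) : ℝ≥0∞ :=
  ⨅ p ∈ Lsol a, ((Finset.univ.sup p : ℕ) : ℝ≥0∞)

/-- The condition `𝔪(a)³ ≤ |a|·(log |a|)⁴·(log log |a|)`. -/
def SmallSol (a : Fin 4 → ℤ) : Prop :=
  (mfrak a) ^ 3 ≤ ENNReal.ofReal ((snorm a : ℝ) * (Real.log (snorm a)) ^ 4 *
    Real.log (Real.log (snorm a)))

/-- `𝕃^loc(A)`. -/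
def LlocSet (A : ℝ) : Set (Fin 4 → ℤ) := {a | IsLocSolv a ∧ znorm a ≤ A}

/-- `𝕃(A)`. -/
def LSet (A : ℝ) : Set (Fin 4 → ℤ) := {a | IsPrimitive a ∧ znorm a ≤ A}

/-- `𝒫(B)`: quadruples of primes of sup-norm at most `B`. -/
def PP (B : ℝ) : Set (Fin 4 → ℕ) := {x | ∀ i, (x i).Prime ∧ (x i : ℝ) ≤ B}

/-- The counting function `N_a(B)`. -/
def NB (a : Fin 4 → ℤ) (B : ℝ) : ℝ :=
  (Real.log B) ^ 4 * (Set.ncard {x | x ∈ PP B ∧ ∑ i, a i * (x i : ℤ) = 0} : ℝ)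

/-- `w = log log B / log log log B`. -/
def wB (B : ℝ) : ℝ := Real.log (Real.log B) / Real.log (Real.log (Real.log B))

/-- `W = ∏_{p ≤ w} p^(⌈log w/log p⌉ + 1)`. -/
def WB (B : ℝ) : ℕ :=
  ∏ p ∈ Finset.filter Nat.Prime (Finset.range (⌊wB B⌋₊ + 1)),
    p ^ (⌈Real.log (wB B) / Real.log (p : ℝ)⌉₊ + 1)

/-- `rad(W) = ∏_{p ≤ w} p`. -/
def radWB (B : ℝ) : ℕ :=
  ∏ p ∈ Finset.filter Nat.Prime (Finset.range (⌊wB B⌋₊ + 1)), p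

/-- The local counting function `N_a^loc(B)`; the summation condition is
`a ∈ Λ_x^(W) ∩ 𝒞_x^(α)` with `α = log B`. -/
def NlocB (a : Fin 4 → ℤ) (B : ℝ) : ℝ :=
  (Real.log B) ^ 4 * (Real.log B * (WB B : ℝ) / znorm a) *
    ∑ᶠ x ∈ {x : Fin 4 → ℕ | x ∈ PP B ∧ ((WB B : ℤ) ∣ ∑ i, a i * (x i : ℤ)) ∧
      |∑ i, (x i : ℝ) * (a i : ℝ)| ≤ pnorm x * znorm a / (2 * Real.log B)},
      1 / pnorm x

/-- Gram determinant `‖u‖²‖v‖² − ⟨u,v⟩²` of a pair of real vectors. -/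
def gram2 (u v : Fin 4 → ℝ) : ℝ :=
  (∑ i, u i ^ 2) * (∑ i, v i ^ 2) - (∑ i, u i * v i) ^ 2

/-- Determinant of a rank-2 lattice `S ⊆ ℤ⁴`: for such a lattice it is the minimum of
`det(ℤu ⊕ ℤv) = √(‖u‖²‖v‖² − ⟨u,v⟩²)` over linearly independent pairs `u, v ∈ S`
(the minimum being attained precisely at bases of `S`). -/
def latDet2 (S : Set (Fin 4 → ℤ)) : ℝ :=
  sInf {d : ℝ | ∃ u ∈ S, ∃ v ∈ S,
    (∀ m n : ℤ, m • u + n • v = 0 → m = 0 ∧ n = 0) ∧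
    d = Real.sqrt (gram2 (fun i => (u i : ℝ)) (fun i => (v i : ℝ)))}

/-- `det(Λ_x ∩ Λ_y)` for quadruples of primes `x, y`. -/
def detXY (x y : Fin 4 → ℕ) : ℝ :=
  latDet2 {z | (∑ i, (x i : ℤ) * z i) = 0 ∧ (∑ i, (y i : ℤ) * z i) = 0}

/-- `Ω(B)`: pairs of distinct quadruples of primes of size at most `B`. -/
def OmegaB (B : ℝ) : Set ((Fin 4 → ℕ) × (Fin 4 → ℕ)) :=
  {p | p.1 ∈ PP B ∧ p.2 ∈ PP B ∧ p.1 ≠ p.2}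

/-- `E(B)`. -/
def EB (B : ℝ) : ℝ :=
  (Real.log B) ^ 8 * ∑ᶠ p ∈ OmegaB B, 1 / detXY p.1 p.2

/-- `𝒢(x,y)`: the gcd of the 2×2 minors of the matrix with columns `x, y`. -/
def Gcal (x y : Fin 4 → ℕ) : ℤ :=
  Finset.univ.gcd fun q : Fin 4 × Fin 4 =>
    (x q.1 : ℤ) * (y q.2 : ℤ) - (x q.2 : ℤ) * (y q.1 : ℤ)

/-- `Δ(x,y) = ‖x‖‖y‖/det(ℤx ⊕ ℤy)`. -/
def DeltaXY (x y : Fin 4 → ℕ) : ℝ :=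
  pnorm x * pnorm y / Real.sqrt (gram2 (fun i => (x i : ℝ)) (fun i => (y i : ℝ)))

/-- `ℰ_{x,y}(B) = min{1, Δ(x,y)²/α²} + 𝟏[𝒢(x,y) ∤ W/rad(W)]`. -/
def EcalXY (x y : Fin 4 → ℕ) (B : ℝ) : ℝ :=
  min 1 (DeltaXY x y ^ 2 / (Real.log B) ^ 2) +
  (if Gcal x y ∣ ((WB B / radWB B : ℕ) : ℤ) then 0 else 1)

/-- `F(B)`. -/
def FB (B : ℝ) : ℝ :=
  (Real.log B) ^ 8 * ∑ᶠ p ∈ OmegaB B, EcalXY p.1 p.2 B / detXY p.1 p.2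

/-- `ζ(2)`. -/
def zeta2 : ℝ := ∑' n : ℕ, (1 : ℝ) / (n + 1) ^ 2

/-- `{a ∈ ℤ⁴_prim : ‖a‖ ≤ A}` with `ℤ⁴_prim` the tuples of coprime coordinates. -/
def primA (A : ℝ) : Set (Fin 4 → ℤ) := {a | Finset.univ.gcd a = 1 ∧ znorm a ≤ A}

/-- `D(A,B)`. -/
def DAB (A B : ℝ) : ℝ :=
  (∑ᶠ a ∈ primA A, NB a B ^ 2) - (Real.log B) ^ 4 * ∑ᶠ a ∈ primA A, NB a B

/-- `Δ_a^mix(B)`. -/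
def DeltaMix (a : Fin 4 → ℤ) (B : ℝ) : ℝ :=
  (Real.log B) ^ 8 * (Real.log B * (WB B : ℝ) / znorm a) *
    ∑ᶠ x ∈ {x : Fin 4 → ℕ | x ∈ PP B ∧ ∑ i, a i * (x i : ℤ) = 0}, 1 / pnorm x

/-- `Δ_a^loc(B)`. -/
def DeltaLoc (a : Fin 4 → ℤ) (B : ℝ) : ℝ :=
  (Real.log B) ^ 8 * ((Real.log B) ^ 2 * (WB B : ℝ) ^ 2 / znorm a ^ 2) *
    ∑ᶠ x ∈ {x : Fin 4 → ℕ | x ∈ PP B ∧ ((WB B : ℤ) ∣ ∑ i, a i * (x i : ℤ)) ∧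
      |∑ i, (x i : ℝ) * (a i : ℝ)| ≤ pnorm x * znorm a / (2 * Real.log B)},
      1 / pnorm x ^ 2

/-- `D^mix(A,B)`. -/
def DmixAB (A B : ℝ) : ℝ :=
  (∑ᶠ a ∈ primA A, NB a B * NlocB a B) - ∑ᶠ a ∈ primA A, DeltaMix a B

/-- `D^loc(A,B)`. -/
def DlocAB (A B : ℝ) : ℝ :=
  (∑ᶠ a ∈ primA A, NlocB a B ^ 2) - ∑ᶠ a ∈ primA A, DeltaLoc a B

/-- `K(A,B)`. -/
def KAB (A B : ℝ) : ℝ :=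
  ∑ᶠ a ∈ primA A, ((Real.log B) ^ 4 * NB a B + DeltaMix a B + DeltaLoc a B)

/-- `τ(a,γ) = γ·vol({u ∈ 𝓑₄(1) ∩ ℝ⁴₊ : a ∈ 𝒞_u^(γ)})`. -/
def tauA (a : Fin 4 → ℤ) (γ : ℝ) : ℝ :=
  γ * (volume {u : Fin 4 → ℝ | Real.sqrt (∑ i, u i ^ 2) < 1 ∧ (∀ i, 0 < u i) ∧
      |∑ i, u i * (a i : ℝ)| ≤ Real.sqrt (∑ i, u i ^ 2) * znorm a / (2 * γ)}).toReal

/-- The singular integral `𝔍_a(B) = τ(a, log B)`. -/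
def Jfrak (a : Fin 4 → ℤ) (B : ℝ) : ℝ := tauA a (Real.log B)

/-- `σ(a,Q) = (Q/φ(Q)⁴)·#{b ∈ ((ℤ/Qℤ)^*)⁴ : ⟨a,b⟩ ≡ 0 mod Q}`. -/
def sigmaA (a : Fin 4 → ℤ) (Q : ℕ) : ℝ :=
  (Q : ℝ) / (Nat.totient Q : ℝ) ^ 4 *
    (Nat.card {b : Fin 4 → (ZMod Q)ˣ |
      ∑ i, (a i : ZMod Q) * ((b i : (ZMod Q)ˣ) : ZMod Q) = 0} : ℝ)

/-- The truncated singular series `𝔖_a(B) = σ(a, W)`. -/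
def Sfrak (a : Fin 4 → ℤ) (B : ℝ) : ℝ := sigmaA a (WB B)

end

/-- In a finite commutative ring, unit solutions of a linear equation with a unit coefficient
`a i` are at least as many as the tuples of remaining unit coordinates giving a unit sum. -/
theorem card_units_sum_isUnit_le {R : Type*} [CommRing R] [Finite R] (a : Fin 4 → R) (i : Fin 4)
    (hi : IsUnit (a i)) :
    Nat.card {c : Fin 3 → Rˣ | IsUnit (∑ j, a (i.succAbove j) * (c j : R))} ≤
      Nat.card {b : Fin 4 → Rˣ | ∑ j, a j * (b j : R) = 0} := by
  obtain ⟨v, hv⟩ := hi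
  refine Nat.card_le_card_of_injective
    (fun c : {c : Fin 3 → Rˣ | IsUnit (∑ j, a (i.succAbove j) * (c j : R))} =>
      (⟨i.insertNth (-(v⁻¹ * c.2.unit)) c.1, ?_⟩ :
        {b : Fin 4 → Rˣ | ∑ j, a j * (b j : R) = 0})) ?_
  · simp [Fin.sum_univ_succAbove _ i, ← hv]
  · intro c d h
    have h' := congrArg (fun b => i.removeNth b.1) h
    simpa [Subtype.ext_iff] using h'

/-- Among triples of units, those whose image under a linear form with a unit coefficient is not a
unit are few. -/
theorem card_not_isUnit_sum_le {R : Type*} [CommRing R] [Finite R] (a : Fin 3 → R) (l : Fin 3)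
    (hl : IsUnit (a l)) :
    Nat.card {c : Fin 3 → Rˣ | ¬ IsUnit (∑ j, a j * (c j : R))} ≤
      Nat.card Rˣ ^ 2 * Nat.card {x : R | ¬ IsUnit x} := by
  have hcard : Nat.card ((Fin 2 → Rˣ) × {x : R | ¬ IsUnit x}) =
      Nat.card Rˣ ^ 2 * Nat.card {x : R | ¬ IsUnit x} := by
    rw [Nat.card_prod, Nat.card_fun]; simp
  rw [← hcard]
  refine Nat.card_le_card_of_injective
    (fun c : {c : Fin 3 → Rˣ | ¬ IsUnit (∑ j, a j * (c j : R))} =>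
      (l.removeNth c.1, (⟨∑ j, a j * (c.1 j : R), c.2⟩ : {x : R | ¬ IsUnit x}))) ?_
  rintro ⟨c, hc⟩ ⟨d, hd⟩ h
  simp only [Prod.mk.injEq, Subtype.mk.injEq] at h
  obtain ⟨h1, h2⟩ := h
  have h3 : ∀ j, c (l.succAbove j) = d (l.succAbove j) := fun j => congrFun h1 j
  simp only [Fin.sum_univ_succAbove _ l, h3, add_left_inj] at h2
  have h4 : c l = d l := Units.ext (hl.mul_left_cancel h2)
  refine Subtype.ext (funext fun j => ?_)
  rcases Fin.eq_self_or_eq_succAbove l j with rfl | ⟨k, rfl⟩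
  · exact h4
  · exact h3 k

theorem card_isUnit_add_card_not_isUnit {R : Type*} [CommRing R] [Finite R] :
    Nat.card Rˣ + Nat.card {x : R | ¬ IsUnit x} = Nat.card R := by
  have h1 : Nat.card Rˣ = Nat.card {x : R | IsUnit x} := by
    refine Nat.card_congr (Equiv.ofBijective (fun u => ⟨(u : R), u.isUnit⟩) ⟨?_, ?_⟩)
    · intro u v h
      exact Units.ext (by simpa using h)
    · rintro ⟨x, u, rfl⟩
      exact ⟨u, rfl⟩
  rw [h1, Nat.card_coe_set_eq, Nat.card_coe_set_eq]
  exact Set.ncard_add_ncard_compl {x : R | IsUnit x}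

/-- Lower bound for the number of unit solutions of a linear equation in four variables having two
unit coefficients, over a finite commutative ring. -/
theorem card_units_cube_le {R : Type*} [CommRing R] [Finite R] (a : Fin 4 → R) {i l : Fin 4}
    (hil : l ≠ i) (hi : IsUnit (a i)) (hl : IsUnit (a l)) :
    Nat.card Rˣ ^ 3 ≤ Nat.card {b : Fin 4 → Rˣ | ∑ j, a j * (b j : R) = 0} +
      Nat.card Rˣ ^ 2 * Nat.card {x : R | ¬ IsUnit x} := by
  obtain ⟨k, rfl⟩ := Fin.exists_succAbove_eq hil
  have h1 := card_units_sum_isUnit_le a i hi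
  have h2 := card_not_isUnit_sum_le (fun j => a (i.succAbove j)) k hl
  have h3 : Nat.card {c : Fin 3 → Rˣ | IsUnit (∑ j, a (i.succAbove j) * (c j : R))} +
      Nat.card {c : Fin 3 → Rˣ | ¬ IsUnit (∑ j, a (i.succAbove j) * (c j : R))} =
      Nat.card Rˣ ^ 3 := by
    rw [Nat.card_coe_set_eq, Nat.card_coe_set_eq]
    have := Set.ncard_add_ncard_compl
      {c : Fin 3 → Rˣ | IsUnit (∑ j, a (i.succAbove j) * (c j : R))}
    rw [Nat.card_fun, Nat.card_fin] at this
    exact this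
  omega

theorem ZMod.isUnit_of_castHom_ne_zero {p k : ℕ} (hp : p.Prime) (x : ZMod (p ^ (k + 1)))
    (hx : ZMod.castHom (dvd_pow_self p k.succ_ne_zero) (ZMod p) x ≠ 0) : IsUnit x := by
  have : NeZero (p ^ (k + 1)) := ⟨pow_ne_zero _ hp.ne_zero⟩
  obtain ⟨n, rfl⟩ := ZMod.natCast_zmod_surjective x
  rw [map_natCast, Ne, ZMod.natCast_eq_zero_iff] at hx
  rw [ZMod.isUnit_iff_coprime]
  exact ((hp.coprime_iff_not_dvd.2 hx).symm).pow_right _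

theorem IsLocSolv.exists_two_not_dvd {a : Fin 4 → ℤ} (ha : IsLocSolv a) {p : ℕ} (hp : p.Prime) :
    ∃ i l : Fin 4, l ≠ i ∧ (a i : ZMod p) ≠ 0 ∧ (a l : ZMod p) ≠ 0 := by
  have := Fact.mk hp
  obtain ⟨⟨-, hg⟩, -, hs⟩ := ha
  obtain ⟨i, hi⟩ : ∃ i, (a i : ZMod p) ≠ 0 := by
    by_contra! h
    have h1 : (p : ℤ) ∣ Finset.univ.gcd a :=
      Finset.dvd_gcd fun i _ => (ZMod.intCast_zmod_eq_zero_iff_dvd _ _).1 (h i)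
    rw [hg] at h1
    exact hp.one_lt.ne' (by exact_mod_cast Int.eq_one_of_dvd_one (by positivity) h1)
  refine ⟨i, ?_⟩
  by_contra! h
  obtain ⟨x, hx⟩ := hs p hp
  rw [Finset.sum_eq_single i (fun l _ hl => by simp [h l hl hi]) (by simp)] at hx
  exact hi (by simpa using hx)

theorem sigmaA_eq_ratio {a : Fin 4 → ℤ} {p k : ℕ} (hp : p.Prime) :
    sigmaA a (p ^ (k + 1)) = p / (p - 1) *
      ((Nat.card {b : Fin 4 → (ZMod (p ^ (k + 1)))ˣ | ∑ i, (a i : ZMod (p ^ (k + 1))) *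
        ((b i : (ZMod (p ^ (k + 1)))ˣ) : ZMod (p ^ (k + 1))) = 0} : ℝ) /
        (Nat.totient (p ^ (k + 1)) : ℝ) ^ 3) := by
  have hp1 : (1 : ℝ) < p := by exact_mod_cast hp.one_lt
  have h1 : (p : ℝ) - 1 ≠ 0 := by linarith
  have h2 : (p : ℝ) ≠ 0 := by linarith
  unfold sigmaA
  rw [Nat.totient_prime_pow_succ hp]
  push_cast [hp.one_le]
  field_simp
  ring

theorem IsLocSolv.le_sigmaA_prime_pow {a : Fin 4 → ℤ} (ha : IsLocSolv a) {p : ℕ} (hp : p.Prime)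
    (k : ℕ) : (p : ℝ) * (p - 2) / (p - 1) ^ 2 ≤ sigmaA a (p ^ (k + 1)) := by
  have : NeZero (p ^ (k + 1)) := ⟨pow_ne_zero _ hp.ne_zero⟩
  have hp1 : (1 : ℝ) < p := by exact_mod_cast hp.one_lt
  have h1 : (0 : ℝ) < (p : ℝ) - 1 := by linarith
  obtain ⟨i, l, hil, hi, hl⟩ := ha.exists_two_not_dvd hp
  have key := card_units_cube_le (R := ZMod (p ^ (k + 1))) (fun j => (a j : ZMod (p ^ (k + 1)))) hil
    (ZMod.isUnit_of_castHom_ne_zero hp _ (by simpa using hi))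
    (ZMod.isUnit_of_castHom_ne_zero hp _ (by simpa using hl))
  have key2 := card_isUnit_add_card_not_isUnit (R := ZMod (p ^ (k + 1)))
  rw [Nat.card_eq_fintype_card (α := (ZMod (p ^ (k + 1)))ˣ), ZMod.card_units_eq_totient] at key key2
  rw [Nat.card_zmod] at key2
  rw [sigmaA_eq_ratio hp]
  set M := Nat.card {b : Fin 4 → (ZMod (p ^ (k + 1)))ˣ | ∑ i, (a i : ZMod (p ^ (k + 1))) *
        ((b i : (ZMod (p ^ (k + 1)))ˣ) : ZMod (p ^ (k + 1))) = 0}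
  set ν := Nat.card {x : ZMod (p ^ (k + 1)) | ¬ IsUnit x}
  have hk2 : (Nat.totient (p ^ (k + 1)) : ℝ) + ν = (p : ℝ) ^ (k + 1) := by exact_mod_cast key2
  have hk : (Nat.totient (p ^ (k + 1)) : ℝ) ^ 3 ≤
      M + (Nat.totient (p ^ (k + 1)) : ℝ) ^ 2 * ν := by exact_mod_cast key
  have ht : (Nat.totient (p ^ (k + 1)) : ℝ) = p ^ k * (p - 1) := by
    rw [Nat.totient_prime_pow_succ hp]; push_cast [hp.one_le]; ring
  have hν : (ν : ℝ) = p ^ k := by rw [ht] at hk2; linear_combination hk2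
  rw [ht, hν] at hk
  rw [ht]
  have hpk : (0 : ℝ) < (p : ℝ) ^ k := by positivity
  have h3 : ((p : ℝ) - 2) / (p - 1) ≤ M / ((p : ℝ) ^ k * (p - 1)) ^ 3 := by
    rw [div_le_div_iff₀ h1 (by positivity)]
    nlinarith
  calc (p : ℝ) * (p - 2) / (p - 1) ^ 2 = p / (p - 1) * ((p - 2) / (p - 1)) := by
        field_simp
    _ ≤ _ := by gcongr

theorem IsLocSolv.one_le_sigmaA_two_pow {a : Fin 4 → ℤ} (ha : IsLocSolv a) (k : ℕ) :
    1 ≤ sigmaA a (2 ^ (k + 1)) := by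
  obtain ⟨i, -, -, hi, -⟩ := ha.exists_two_not_dvd Nat.prime_two
  have hiu : IsUnit (a i : ZMod (2 ^ (k + 1))) :=
    ZMod.isUnit_of_castHom_ne_zero Nat.prime_two _ (by simpa using hi)
  have h := card_units_sum_isUnit_le (R := ZMod (2 ^ (k + 1)))
    (fun j => (a j : ZMod (2 ^ (k + 1)))) i hiu
  obtain ⟨x, hx⟩ := ha.2.2 2 Nat.prime_two
  have hone : ∀ u : (ZMod 2)ˣ, (u : ZMod 2) = 1 := by decide
  simp only [hone, mul_one, Fin.sum_univ_succAbove _ i] at hx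
  have hall : {c : Fin 3 → (ZMod (2 ^ (k + 1)))ˣ | IsUnit (∑ j,
      (a (i.succAbove j) : ZMod (2 ^ (k + 1))) * (c j : ZMod (2 ^ (k + 1))))} = Set.univ := by
    refine Set.eq_univ_of_forall fun c => ZMod.isUnit_of_castHom_ne_zero Nat.prime_two _ ?_
    have hc : ∀ j, ZMod.castHom (dvd_pow_self 2 k.succ_ne_zero) (ZMod 2)
        (c j : ZMod (2 ^ (k + 1))) = 1 := fun j =>
      hone (Units.map (ZMod.castHom (dvd_pow_self 2 k.succ_ne_zero) (ZMod 2)).toMonoidHom (c j))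
    simp only [map_sum, map_mul, hc, map_intCast, mul_one]
    intro h0
    exact hi (by simpa [h0] using hx)
  rw [hall, Nat.card_coe_set_eq, Set.ncard_univ, Nat.card_fun,
    Nat.card_eq_fintype_card (α := (ZMod (2 ^ (k + 1)))ˣ), ZMod.card_units_eq_totient] at h
  rw [sigmaA_eq_ratio Nat.prime_two]
  have ht : (0 : ℝ) < (Nat.totient (2 ^ (k + 1)) : ℝ) := by
    exact_mod_cast Nat.totient_pos.2 (by positivity)
  have h2 : (1 : ℝ) ≤ (Nat.card {b : Fin 4 → (ZMod (2 ^ (k + 1)))ˣ |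
      ∑ i, (a i : ZMod (2 ^ (k + 1))) * ((b i : (ZMod (2 ^ (k + 1)))ˣ) : ZMod (2 ^ (k + 1))) = 0}
      : ℝ) / (Nat.totient (2 ^ (k + 1)) : ℝ) ^ 3 := by
    rw [one_le_div (by positivity)]
    simp only [Nat.card_eq_fintype_card (α := Fin 3), Fintype.card_fin] at h
    exact_mod_cast h
  refine h2.trans (le_mul_of_one_le_left (by positivity) (by norm_num))

theorem card_unit_solutions_congr {R S : Type*} [CommRing R] [CommRing S] (e : R ≃+* S)
    (a : Fin 4 → ℤ) :
    Nat.card {b : Fin 4 → Rˣ | ∑ i, (a i : R) * (b i : R) = 0} =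
      Nat.card {b : Fin 4 → Sˣ | ∑ i, (a i : S) * (b i : S) = 0} := by
  refine Nat.card_congr (Equiv.subtypeEquiv
    (Equiv.arrowCongr (Equiv.refl _) (Units.mapEquiv e.toMulEquiv).toEquiv) fun b => ?_)
  simp only [Set.mem_ofPred_eq]
  rw [← map_eq_zero_iff e e.injective]
  simp

theorem card_unit_solutions_prod {R S : Type*} [CommRing R] [CommRing S] (a : Fin 4 → ℤ) :
    Nat.card {b : Fin 4 → (R × S)ˣ | ∑ i, (a i : R × S) * (b i : R × S) = 0} =
      Nat.card {b : Fin 4 → Rˣ | ∑ i, (a i : R) * (b i : R) = 0} *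
        Nat.card {b : Fin 4 → Sˣ | ∑ i, (a i : S) * (b i : S) = 0} := by
  rw [← Nat.card_prod]
  refine Nat.card_congr (((Equiv.arrowCongr (Equiv.refl _) MulEquiv.prodUnits.toEquiv).trans
    (Equiv.arrowProdEquivProdArrow _ _ _)).subtypeEquiv (fun b => ?_) |>.trans
    Equiv.subtypeProdEquivProd)
  simp [Prod.ext_iff, Prod.fst_sum, Prod.snd_sum, MulEquiv.prodUnits]

theorem sigmaA_mul (a : Fin 4 → ℤ) {m n : ℕ} (h : m.Coprime n) :
    sigmaA a (m * n) = sigmaA a m * sigmaA a n := by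
  unfold sigmaA
  rw [card_unit_solutions_congr (ZMod.chineseRemainder h), card_unit_solutions_prod,
    Nat.totient_mul h]
  push_cast
  ring

theorem sigmaA_one (a : Fin 4 → ℤ) : sigmaA a 1 = 1 := by
  have h : {b : Fin 4 → (ZMod 1)ˣ | ∑ i, (a i : ZMod 1) * (b i : ZMod 1) = 0} = Set.univ :=
    Set.eq_univ_of_forall fun _ => Subsingleton.elim _ _
  unfold sigmaA
  rw [h]
  simp

theorem sigmaA_prod_prime_pow (a : Fin 4 → ℤ) (s : Finset ℕ) (hs : ∀ p ∈ s, p.Prime)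
    (e : ℕ → ℕ) : sigmaA a (∏ p ∈ s, p ^ e p) = ∏ p ∈ s, sigmaA a (p ^ e p) := by
  induction s using Finset.induction_on with
  | empty => simp [sigmaA_one]
  | insert q s hq ih =>
    rw [Finset.prod_insert hq, Finset.prod_insert hq, sigmaA_mul, ih]
    · exact fun p hp => hs p (Finset.mem_insert_of_mem hp)
    · refine Nat.Coprime.prod_right fun p hp => Nat.Coprime.pow _ _ ?_
      rw [Nat.coprime_primes (hs q (Finset.mem_insert_self _ _))
        (hs p (Finset.mem_insert_of_mem hp))]
      rintro rfl
      exact hq hp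

theorem IsLocSolv.half_le_prod_sigmaA {a : Fin 4 → ℤ} (ha : IsLocSolv a) (e : ℕ → ℕ) (N : ℕ) :
    (1 : ℝ) / 2 ≤ ∏ p ∈ Finset.filter Nat.Prime (Finset.range (N + 1)),
      sigmaA a (p ^ (e p + 1)) := by
  rcases lt_or_ge N 2 with hN | hN
  · have : Finset.filter Nat.Prime (Finset.range (N + 1)) = ∅ := by
      interval_cases N <;> decide
    rw [this]
    norm_num
  · have key : (N : ℝ) / (2 * (N - 1)) ≤
        ∏ p ∈ Finset.filter Nat.Prime (Finset.range (N + 1)), sigmaA a (p ^ (e p + 1)) := by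
      induction N, hN using Nat.le_induction with
      | base =>
        have : Finset.filter Nat.Prime (Finset.range (2 + 1)) = {2} := by decide
        rw [this, Finset.prod_singleton]
        have := ha.one_le_sigmaA_two_pow (e 2)
        norm_num
        exact this
      | succ N hN ih =>
        have hN2 : (2 : ℝ) ≤ N := by exact_mod_cast hN
        have hN1 : (0 : ℝ) < (N : ℝ) - 1 := by linarith
        rw [Finset.range_add_one, Finset.filter_insert]
        split_ifs with hp
        · rw [Finset.prod_insert (by simp)]
          have h1 := ha.le_sigmaA_prime_pow hp (e (N + 1))
          push_cast at h1 ⊢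
          calc ((N : ℝ) + 1) / (2 * (N + 1 - 1))
              = ((N + 1) * (N + 1 - 2) / (N + 1 - 1) ^ 2) * (N / (2 * (N - 1))) := by
                have : (N : ℝ) + 1 - 2 = N - 1 := by ring
                rw [this, add_sub_cancel_right]
                field_simp
            _ ≤ _ := by
                refine mul_le_mul h1 ih (by positivity) (le_trans ?_ h1)
                have : (N : ℝ) + 1 - 2 = N - 1 := by ring
                rw [this]
                positivity
        · refine le_trans ?_ ih
          push_cast
          rw [div_le_div_iff₀ (by linarith) (by linarith)]
          nlinarith
    refine le_trans ?_ key
    have hN2 : (2 : ℝ) ≤ N := by exact_mod_cast hN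
    rw [div_le_div_iff₀ (by norm_num) (by linarith)]
    linarith

theorem IsLocSolv.half_le_Sfrak {a : Fin 4 → ℤ} (ha : IsLocSolv a) (B : ℝ) :
    1 / 2 ≤ Sfrak a B := by
  unfold Sfrak WB
  rw [sigmaA_prod_prime_pow a _ (fun p hp => (Finset.mem_filter.1 hp).2)]
  exact ha.half_le_prod_sigmaA _ _

/-- The slab-in-orthant region has volume at least a constant times `m ^ 2 / γ`, for a unit vector
`b` of mixed signs whose coordinates are at least `m` in absolute value. Here the coordinate of
largest absolute value is assumed positive. -/
theorem le_volume_slab_of_pos {b : Fin 4 → ℝ} {m γ : ℝ} (hγ : 2 / 3 ≤ γ) (hm : 0 < m)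
    (hb : ∑ k, b k ^ 2 = 1) (hmb : ∀ k, m ≤ |b k|) {i j : Fin 4} (hi : 0 < b i)
    (hmax : ∀ k, |b k| ≤ |b i|) (hj : b j < 0) :
    ENNReal.ofReal (m ^ 2 / (131072 * γ)) ≤
      volume {u : Fin 4 → ℝ | Real.sqrt (∑ k, u k ^ 2) < 1 ∧ (∀ k, 0 < u k) ∧
        |∑ k, u k * b k| ≤ Real.sqrt (∑ k, u k ^ 2) / (2 * γ)} := by
  have hγ0 : 0 < γ := by linarith
  have hij : j ≠ i := by rintro rfl; linarith
  rw [abs_of_pos hi] at hmax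
  have hb1 : b i ≤ 1 := by
    have := Finset.single_le_sum (f := fun k => b k ^ 2) (fun k _ => sq_nonneg _)
      (Finset.mem_univ i)
    simp only [hb] at this
    nlinarith
  have hbh : 1 / 2 ≤ b i := by
    have : ∑ k, b k ^ 2 ≤ ∑ _k : Fin 4, b i ^ 2 :=
      Finset.sum_le_sum fun k _ => by
        rw [← sq_abs]; exact pow_le_pow_left₀ (abs_nonneg _) (hmax k) 2
    simp [hb] at this
    nlinarith
  have hm1 : m ≤ 1 := (hmb i).trans ((hmax i).trans hb1)
  set M : Matrix (Fin 4) (Fin 4) ℝ := (1 : Matrix (Fin 4) (Fin 4) ℝ).updateRow i b with hM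
  have hdet : M.det = b i := by
    rw [hM, ← Matrix.cramer_transpose_apply]
    simp
  have hMi : ∀ u, Matrix.toLin' M u i = ∑ k, b k * u k := fun u => by
    simp [hM, Matrix.mulVec, dotProduct]
  have hMk : ∀ u k, k ≠ i → Matrix.toLin' M u k = u k := fun u k hk => by
    simp [hM, Matrix.mulVec, dotProduct, Matrix.updateRow_ne hk, Matrix.one_apply]
  set lo : Fin 4 → ℝ := fun k => if k = j then 1 / 8 else 0 with hlo
  set hi' : Fin 4 → ℝ := fun k => if k = i then 1 / (16 * γ) else if k = j then 1 / 4 else m / 32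
    with hhi
  have hvol : ENNReal.ofReal (m ^ 2 / (131072 * γ)) =
      volume (Set.pi Set.univ fun k => Set.Ioo (lo k) (hi' k)) := by
    rw [Real.volume_pi_Ioo, ← ENNReal.ofReal_prod_of_nonneg]
    · congr 1
      have : ∏ k, (hi' k - lo k) = (1 / (16 * γ)) * (1 / 8) * (m / 32) ^ 2 := by
        fin_cases i <;> fin_cases j <;> simp_all [Fin.prod_univ_four] <;> ring
      rw [this]
      field_simp
      norm_num
    · intro k _
      simp only [hlo, hhi]
      by_cases h1 : k = i
      · simp only [h1, hij.symm, if_true, if_false]; simp; positivity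
      · by_cases h2 : k = j
        · simp [h2, hij]; norm_num
        · simp [h1, h2]; positivity
  rw [hvol]
  calc volume (Set.pi Set.univ fun k => Set.Ioo (lo k) (hi' k))
      ≤ volume (Matrix.toLin' M ⁻¹' (Set.pi Set.univ fun k => Set.Ioo (lo k) (hi' k))) := by
        rw [Measure.addHaar_preimage_linearMap _ (by rw [LinearMap.det_toLin', hdet]; exact hi.ne'),
          LinearMap.det_toLin', hdet]
        refine le_mul_of_one_le_left zero_le ?_
        rw [ENNReal.one_le_ofReal, abs_of_pos (inv_pos.2 hi)]
        exact (one_le_inv₀ hi).2 hb1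
    _ ≤ _ := measure_mono ?_
  intro u hu
  have hu' : ∀ k, lo k < Matrix.toLin' M u k ∧ Matrix.toLin' M u k < hi' k := fun k =>
    hu k (Set.mem_univ k)
  have hui := hu' i
  have huj := hu' j
  rw [hMi] at hui
  rw [hMk _ _ hij] at huj
  simp only [hlo, hhi, hij, hij.symm, if_true, if_false] at hui huj
  have huk : ∀ k, k ≠ i → k ≠ j → 0 < u k ∧ u k < m / 32 := fun k h1 h2 => by
    have := hu' k
    rw [hMk _ _ h1] at this
    simpa [hlo, hhi, h1, h2] using this
  have hbu : ∀ k, k ≠ i → k ≠ j → |b k * u k| ≤ b i * (m / 32) := fun k h1 h2 => by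
    rw [abs_mul, abs_of_pos (huk k h1 h2).1]
    exact mul_le_mul (hmax k) (huk k h1 h2).2.le (huk k h1 h2).1.le hi.le
  obtain ⟨k, l, hki, hkj, hli, hlj, hsum, hsq⟩ : ∃ k l : Fin 4, k ≠ i ∧ k ≠ j ∧ l ≠ i ∧ l ≠ j ∧
      (∀ f : Fin 4 → ℝ, ∑ k, f k = f i + f j + f k + f l) ∧
      (∀ x : Fin 4, x = i ∨ x = j ∨ x = k ∨ x = l) := by
    have hkl : ∀ i j : Fin 4, j ≠ i → ∃ k l : Fin 4, k ≠ i ∧ k ≠ j ∧ l ≠ i ∧ l ≠ j ∧ k ≠ l ∧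
      (∀ x : Fin 4, x = i ∨ x = j ∨ x = k ∨ x = l) := by decide
    obtain ⟨k, l, h1, h2, h3, h4, h5, h6⟩ := hkl i j hij
    refine ⟨k, l, h1, h2, h3, h4, fun f => ?_, h6⟩
    have : (Finset.univ : Finset (Fin 4)) = {i, j, k, l} := by
      ext x; simpa using h6 x
    rw [this, Finset.sum_insert (by simp [hij.symm, h1.symm, h3.symm]),
      Finset.sum_insert (by simp [h2.symm, h4.symm]), Finset.sum_pair h5]
    ring
  have hk1 := abs_le.1 (hbu k hki hkj)
  have hl1 := abs_le.1 (hbu l hli hlj)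
  have hk0 := huk k hki hkj
  have hl0 := huk l hli hlj
  have hmj : m ≤ -b j := by have := hmb j; rwa [abs_of_neg hj] at this
  have hji : -b j ≤ b i := by have := hmax j; rwa [abs_of_neg hj] at this
  have hγ1 : 1 / (16 * γ) ≤ 3 / 32 := by
    rw [div_le_div_iff₀ (by positivity) (by norm_num)]; linarith
  obtain ⟨hs0, hs1⟩ := hui
  have hs := hsum (fun k => b k * u k)
  have hui0 : 0 < u i := by
    have h1 : m * (1 / 8) ≤ -b j * u j := mul_le_mul hmj huj.1.le (by norm_num) (by linarith)
    have h2 : b i * (m / 32) ≤ m / 32 := by nlinarith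
    have : 0 < b i * u i := by linarith
    exact (mul_pos_iff_of_pos_left hi).1 this
  have hui1 : u i < 3 / 5 := by
    have h1 : -b j * u j ≤ b i * (1 / 4) := mul_le_mul hji huj.2.le (by linarith) hi.le
    have h2 : b i * (m / 32) ≤ b i * (1 / 32) := by gcongr
    have h3 : b i * u i < b i * (3 / 5) := by linarith
    exact lt_of_mul_lt_mul_left h3 hi.le
  have hun := hsum (fun k => u k ^ 2)
  refine ⟨?_, ?_, ?_⟩
  · rw [Real.sqrt_lt' one_pos, hun]
    have h1 : u i ^ 2 < (3 / 5) ^ 2 := pow_lt_pow_left₀ hui1 hui0.le two_ne_zero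
    have h2 : u j ^ 2 < (1 / 4) ^ 2 := pow_lt_pow_left₀ huj.2 (by linarith [huj.1]) two_ne_zero
    have h3 : u k ^ 2 < (1 / 32) ^ 2 := pow_lt_pow_left₀ (by linarith) hk0.1.le two_ne_zero
    have h4 : u l ^ 2 < (1 / 32) ^ 2 := pow_lt_pow_left₀ (by linarith) hl0.1.le two_ne_zero
    linarith
  · intro x
    rcases hsq x with rfl | rfl | rfl | rfl
    · exact hui0
    · linarith
    · exact hk0.1
    · exact hl0.1
  · have h1 : 1 / 8 ≤ Real.sqrt (∑ k, u k ^ 2) := by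
      apply Real.le_sqrt_of_sq_le
      have h2 : (1 / 8) ^ 2 < u j ^ 2 := pow_lt_pow_left₀ huj.1 (by norm_num) two_ne_zero
      rw [hun]
      linarith [sq_nonneg (u i), sq_nonneg (u k), sq_nonneg (u l)]
    have h2 : ∑ k, u k * b k = ∑ k, b k * u k := Finset.sum_congr rfl fun k _ => mul_comm _ _
    rw [h2, abs_of_pos hs0]
    calc ∑ k, b k * u k ≤ 1 / (16 * γ) := hs1.le
      _ = (1 / 8) / (2 * γ) := by field_simp; norm_num
      _ ≤ _ := by gcongr

theorem le_volume_slab {b : Fin 4 → ℝ} {m γ : ℝ} (hγ : 2 / 3 ≤ γ) (hm : 0 < m)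
    (hb : ∑ k, b k ^ 2 = 1) (hmb : ∀ k, m ≤ |b k|)
    (hsign : ¬ ((∀ k, 0 < b k) ∨ (∀ k, b k < 0))) :
    ENNReal.ofReal (m ^ 2 / (131072 * γ)) ≤
      volume {u : Fin 4 → ℝ | Real.sqrt (∑ k, u k ^ 2) < 1 ∧ (∀ k, 0 < u k) ∧
        |∑ k, u k * b k| ≤ Real.sqrt (∑ k, u k ^ 2) / (2 * γ)} := by
  have hne : ∀ k, b k ≠ 0 := fun k => abs_pos.1 (hm.trans_le (hmb k))
  push Not at hsign
  obtain ⟨⟨j, hj⟩, ⟨j', hj'⟩⟩ := hsign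
  obtain ⟨i, hmax⟩ := Finite.exists_max fun k => |b k|
  rcases (hne i).lt_or_gt with hi | hi
  · have := le_volume_slab_of_pos (b := fun k => -b k) (i := i) (j := j') hγ hm (by simpa using hb)
      (by simpa using hmb) (by simpa using hi) (by simpa using hmax)
      (by simpa using lt_of_le_of_ne hj' (hne j').symm)
    simpa using this
  · exact le_volume_slab_of_pos hγ hm hb hmb hi hmax (lt_of_le_of_ne hj (hne j))

theorem le_tauA {a : Fin 4 → ℤ} {m γ : ℝ} (hγ : 2 / 3 ≤ γ) (hm : 0 < m) (hn : 0 < znorm a)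
    (hma : ∀ k, m * znorm a ≤ |(a k : ℝ)|) (hsign : ¬ ((∀ k, 0 < a k) ∨ (∀ k, a k < 0))) :
    m ^ 2 / 131072 ≤ tauA a γ := by
  have hγ0 : 0 < γ := by linarith
  have hpos : ∀ k, 0 < (a k : ℝ) / znorm a ↔ 0 < a k := fun k => by
    rw [div_pos_iff_of_pos_right hn]; exact Int.cast_pos
  have hneg : ∀ k, (a k : ℝ) / znorm a < 0 ↔ a k < 0 := fun k => by
    rw [div_lt_iff₀ hn, zero_mul]; exact Int.cast_lt_zero
  have h := le_volume_slab (b := fun k => (a k : ℝ) / znorm a) hγ hm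
    (by
      simp only [div_pow, ← Finset.sum_div]
      rw [div_eq_one_iff_eq (by positivity), znorm, Real.sq_sqrt (by positivity)])
    (fun k => by rw [abs_div, abs_of_pos hn, le_div_iff₀ hn]; exact hma k)
    (by simpa only [hpos, hneg] using hsign)
  have hset : {u : Fin 4 → ℝ | Real.sqrt (∑ k, u k ^ 2) < 1 ∧ (∀ k, 0 < u k) ∧
        |∑ k, u k * ((a k : ℝ) / znorm a)| ≤ Real.sqrt (∑ k, u k ^ 2) / (2 * γ)} =
      {u : Fin 4 → ℝ | Real.sqrt (∑ i, u i ^ 2) < 1 ∧ (∀ i, 0 < u i) ∧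
      |∑ i, u i * (a i : ℝ)| ≤ Real.sqrt (∑ i, u i ^ 2) * znorm a / (2 * γ)} := by
    ext u
    have h1 : ∑ k, u k * ((a k : ℝ) / znorm a) = (∑ k, u k * (a k : ℝ)) / znorm a := by
      rw [Finset.sum_div]; exact Finset.sum_congr rfl fun k _ => by ring
    simp only [Set.mem_ofPred_eq, h1, abs_div, abs_of_pos hn, div_le_iff₀ hn, div_mul_eq_mul_div]
  rw [hset] at h
  have hfin : volume {u : Fin 4 → ℝ | Real.sqrt (∑ i, u i ^ 2) < 1 ∧ (∀ i, 0 < u i) ∧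
      |∑ i, u i * (a i : ℝ)| ≤ Real.sqrt (∑ i, u i ^ 2) * znorm a / (2 * γ)} ≠ ⊤ := by
    refine ((measure_mono (t := Set.pi Set.univ fun _ => Set.Icc (0 : ℝ) 1) ?_).trans_lt ?_).ne
    · rintro u ⟨h1, h2, -⟩ k -
      refine ⟨(h2 k).le, ?_⟩
      rw [Real.sqrt_lt' one_pos] at h1
      have := Finset.single_le_sum (f := fun k => u k ^ 2) (fun k _ => sq_nonneg _)
        (Finset.mem_univ k)
      nlinarith [h2 k]
    · exact (isCompact_univ_pi fun _ => isCompact_Icc).measure_lt_top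
  rw [ENNReal.ofReal_le_iff_le_toReal hfin] at h
  unfold tauA
  calc m ^ 2 / 131072 = γ * (m ^ 2 / (131072 * γ)) := by field_simp
    _ ≤ _ := by gcongr

/-- The nonzero integers of absolute value at most `X`. -/
noncomputable def nonzeroBall (X : ℝ) : Finset ℤ := (Finset.Icc (-⌊X⌋) ⌊X⌋).erase 0

theorem mem_nonzeroBall {X : ℝ} {x : ℤ} (hx : x ≠ 0) (h : |(x : ℝ)| ≤ X) : x ∈ nonzeroBall X := by
  rw [nonzeroBall, Finset.mem_erase, Finset.mem_Icc, ← abs_le, Int.le_floor]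
  exact ⟨hx, by exact_mod_cast h⟩

theorem card_nonzeroBall_le {X : ℝ} (hX : 0 ≤ X) : ((nonzeroBall X).card : ℝ) ≤ 2 * X := by
  have h0 : 0 ≤ ⌊X⌋ := Int.floor_nonneg.2 hX
  have h : ((nonzeroBall X).card : ℤ) = 2 * ⌊X⌋ := by
    rw [nonzeroBall, Finset.card_erase_of_mem (by simpa using h0), Int.card_Icc]
    omega
  have h' : ((nonzeroBall X).card : ℝ) = 2 * ⌊X⌋ := by exact_mod_cast h
  rw [h']
  linarith [Int.floor_le X]

theorem abs_le_znorm (a : Fin 4 → ℤ) (i : Fin 4) : |(a i : ℝ)| ≤ znorm a := by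
  refine Real.abs_le_sqrt ?_
  exact Finset.single_le_sum (f := fun k => (a k : ℝ) ^ 2) (fun k _ => sq_nonneg _)
    (Finset.mem_univ i)

/-- Few integer quadruples of norm at most `A` with nonzero coordinates have a coordinate of
absolute value at most `X`. -/
theorem ncard_small_coordinate_le {A X : ℝ} (hA : 0 ≤ A) (hX : 0 ≤ X) (S : Set (Fin 4 → ℤ))
    (hS : ∀ a ∈ S, (∀ i, a i ≠ 0) ∧ znorm a ≤ A ∧ ∃ i, |(a i : ℝ)| ≤ X) :
    (S.ncard : ℝ) ≤ 64 * X * A ^ 3 := by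
  set T : Fin 4 → Finset (Fin 4 → ℤ) := fun i =>
    Fintype.piFinset (fun j => nonzeroBall (if j = i then X else A)) with hT
  have hsub : S ⊆ ((Finset.univ.biUnion T : Finset (Fin 4 → ℤ)) : Set (Fin 4 → ℤ)) := by
    intro a ha
    obtain ⟨h0, hn, i, hi⟩ := hS a ha
    simp only [Finset.coe_biUnion, Set.mem_iUnion, hT, Finset.mem_coe, Fintype.mem_piFinset]
    refine ⟨i, Finset.mem_univ i, fun j => mem_nonzeroBall (h0 j) ?_⟩
    split_ifs with h
    · rw [h]; exact hi
    · exact (abs_le_znorm a j).trans hn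
  have hcard : ∀ i, ((T i).card : ℝ) ≤ 16 * X * A ^ 3 := fun i => by
    rw [hT, Fintype.card_piFinset]
    push_cast
    calc ∏ j, ((nonzeroBall (if j = i then X else A)).card : ℝ)
        ≤ ∏ j, 2 * (if j = i then X else A) :=
          Finset.prod_le_prod (fun _ _ => by positivity)
            fun j _ => card_nonzeroBall_le (by split_ifs <;> assumption)
      _ = 16 * X * A ^ 3 := by
          fin_cases i <;> simp [Fin.prod_univ_four] <;> ring
  calc (S.ncard : ℝ) ≤ ((Finset.univ.biUnion T).card : ℝ) := by
        rw [← Set.ncard_coe_finset]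
        exact_mod_cast Set.ncard_le_ncard hsub (Finset.finite_toSet _)
    _ ≤ ((∑ i, (T i).card : ℕ) : ℝ) := by exact_mod_cast Finset.card_biUnion_le
    _ ≤ ∑ _i : Fin 4, 16 * X * A ^ 3 := by push_cast; exact Finset.sum_le_sum fun i _ => hcard i
    _ = 64 * X * A ^ 3 := by simp; ring

theorem loglog_pos {A B : ℝ} (hB : 2 ≤ B) (hA : B ^ 2 ≤ A) : 0 < Real.log (Real.log A) := by
  refine Real.log_pos ?_
  have h4 : (4 : ℝ) ≤ A := by nlinarith
  rw [Real.lt_log_iff_exp_lt (by linarith)]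
  linarith [Real.exp_one_lt_d9]

/-- Lemma 5.5: for `B ≥ 2`, `A ≥ B²` and any `C, κ > 0`,
`#{a ∈ 𝕃^loc(A) : 𝔖_a(B)·𝔍_a(B) ≤ C/(log log A)^κ} ≪ A⁴/(log log A)^{κ/3}`,
the implied constant depending at most on `C` and `κ`. -/
theorem singular_product_rarely_small :
    ∀ C κ : ℝ, 0 < C → 0 < κ → ∃ K > (0 : ℝ),
      ∀ A B : ℝ, 2 ≤ B → B ^ 2 ≤ A →
      (Set.ncard {a | a ∈ LlocSet A ∧
          Sfrak a B * Jfrak a B ≤ C / (Real.log (Real.log A)) ^ κ} : ℝ) ≤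
        K * A ^ 4 / (Real.log (Real.log A)) ^ (κ / 3) := by
  intro C κ hC hκ
  refine ⟨64 * (262144 * C) ^ ((1 : ℝ) / 3), by positivity, fun A B hB hA => ?_⟩
  set L := Real.log (Real.log A)
  have hL : 0 < L := loglog_pos hB hA
  have hA0 : 0 ≤ A := by nlinarith
  have hγ : 2 / 3 ≤ Real.log B := by
    have h1 := Real.log_two_gt_d9
    have h2 := Real.log_le_log two_pos hB
    linarith
  set δ := (262144 * C) ^ ((1 : ℝ) / 3) / L ^ (κ / 3) with hδ
  have hδ0 : 0 < δ := by positivity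
  have hδ3 : δ ^ 3 = 262144 * (C / L ^ κ) := by
    rw [hδ, div_pow, ← Real.rpow_natCast, ← Real.rpow_natCast, ← Real.rpow_mul (by positivity),
      ← Real.rpow_mul hL.le]
    norm_num
    ring
  have h := ncard_small_coordinate_le hA0 (X := δ * A) (by positivity)
    {a | a ∈ LlocSet A ∧ Sfrak a B * Jfrak a B ≤ C / L ^ κ} ?_
  · refine h.trans_eq ?_
    rw [hδ]
    ring
  · rintro a ⟨⟨ha, hn⟩, hSJ⟩
    refine ⟨ha.1.1, hn, ?_⟩
    have hn0 : 0 < znorm a := (abs_pos.2 (by exact_mod_cast ha.1.1 0)).trans_le (abs_le_znorm a 0)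
    obtain ⟨i, hi⟩ := Finite.exists_min fun k => |(a k : ℝ)|
    refine ⟨i, ?_⟩
    set r := |(a i : ℝ)| / znorm a with hr
    have hr0 : 0 < r := div_pos (abs_pos.2 (by exact_mod_cast ha.1.1 i)) hn0
    have hr1 : r ≤ 1 := (div_le_one hn0).2 (abs_le_znorm a i)
    have hrn : r * znorm a = |(a i : ℝ)| := div_mul_cancel₀ _ hn0.ne'
    have hJ : r ^ 2 / 131072 ≤ Jfrak a B :=
      le_tauA hγ hr0 hn0 (fun k => hrn.trans_le (hi k)) ha.2.1
    have hJ' : 1 / 2 * Jfrak a B ≤ Sfrak a B * Jfrak a B :=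
      mul_le_mul_of_nonneg_right (ha.half_le_Sfrak B) (le_trans (by positivity) hJ)
    have hrδ : r ≤ δ := by
      refine le_of_pow_le_pow_left₀ three_ne_zero hδ0.le ?_
      have : r ^ 3 ≤ r ^ 2 := pow_le_pow_of_le_one hr0.le hr1 (by norm_num)
      rw [hδ3]
      linarith
    rw [← hrn]
    exact mul_le_mul hrδ hn hn0.le hδ0.le
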